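/- arXiv:2309.10189 — 2 statements merged into one kernel-verified Lean document; each statement's English description precedes it below -/
import Mathlib

section
/- Let P ≥ 2, Q ≥ 2 be real numbers, let a, b, c, d, e, f be integers in [−Q, Q], and set Δ = 4ac − b² and Θ = 4acf + ebd − ae² − cd² − fb². Let N(P,Q) denote the number of integer solutions (x,y) of a·x² + b·x·y + c·y² + d·x + e·y + f = 0 with |x| ≤ P and |y| ≤ P. If (a² + c²)·Δ·Θ ≠ 0, then for every ε > 0 there is an absolute constant C depending only on ε with N(P,Q) ≤ C·(PQ)^ε. -/
/-- The divisor bound: `d(n) ≪_δ n ^ δ`. -/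
theorem Nat.exists_card_divisors_le_rpow (δ : ℝ) (hδ : 0 < δ) :
    ∃ C : ℝ, 1 ≤ C ∧ ∀ n : ℕ, n ≠ 0 → (n.divisors.card : ℝ) ≤ C * (n : ℝ) ^ δ := by
  have hlog : 0 < δ * Real.log 2 := mul_pos hδ (Real.log_pos one_lt_two)
  set L : ℝ := 1 + 1 / (δ * Real.log 2) with hL
  have hL1 : 1 ≤ L := by rw [hL]; linarith [one_div_pos.2 hlog]
  obtain ⟨N, hN⟩ := exists_nat_ge ((2 : ℝ) ^ (1 / δ))
  have hlocal : ∀ p : ℕ, p.Prime → ∀ k : ℕ,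
      ((k + 1 : ℕ) : ℝ) ≤ (if p < N then L else 1) * ((p : ℝ) ^ k) ^ δ := by
    intro p hp k
    have hp2 : (2 : ℝ) ≤ p := by exact_mod_cast hp.two_le
    rw [← Real.rpow_natCast, ← Real.rpow_mul (by linarith), mul_comm (k : ℝ) δ]
    split_ifs with h
    · have h1 : (2 : ℝ) ^ (δ * k) ≤ (p : ℝ) ^ (δ * k) := by gcongr
      have h2 : 1 + k * (δ * Real.log 2) ≤ (2 : ℝ) ^ (δ * k) := by
        rw [Real.rpow_def_of_pos two_pos]
        have := Real.add_one_le_exp (Real.log 2 * (δ * k))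
        linarith
      have h3 : ((k + 1 : ℕ) : ℝ) ≤ L * (1 + k * (δ * Real.log 2)) := by
        have : L * (1 + k * (δ * Real.log 2)) =
            1 + k + (1 / (δ * Real.log 2) + k * (δ * Real.log 2)) := by
          rw [hL]; field_simp; ring
        rw [this]
        push_cast
        have : 0 ≤ 1 / (δ * Real.log 2) + k * (δ * Real.log 2) := by positivity
        linarith
      exact h3.trans (mul_le_mul_of_nonneg_left (h2.trans h1) (by linarith))
    · have h1 : (2 : ℝ) ≤ (p : ℝ) ^ δ := by
        have : (2 : ℝ) ^ (1 / δ) ≤ p := hN.trans (by exact_mod_cast not_lt.1 h)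
        calc (2 : ℝ) = ((2 : ℝ) ^ (1 / δ)) ^ δ := by
              rw [← Real.rpow_mul two_pos.le, one_div_mul_cancel hδ.ne', Real.rpow_one]
          _ ≤ _ := by gcongr
      rw [one_mul, Real.rpow_mul (by linarith), Real.rpow_natCast]
      calc ((k + 1 : ℕ) : ℝ) ≤ (2 : ℝ) ^ k := by exact_mod_cast Nat.lt_two_pow_self
        _ ≤ _ := by gcongr
  refine ⟨L ^ N, one_le_pow₀ hL1, fun n hn ↦ ?_⟩
  rw [Nat.card_divisors hn, Nat.cast_prod]
  have hnp : (n : ℝ) ^ δ = ∏ p ∈ n.primeFactors, ((p : ℝ) ^ n.factorization p) ^ δ := by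
    rw [Real.finsetProd_rpow _ _ fun i _ ↦ by positivity]
    congr 1
    exact_mod_cast (Nat.prod_factorization_pow_eq_self hn).symm
  calc ∏ p ∈ n.primeFactors, ((n.factorization p + 1 : ℕ) : ℝ)
      ≤ ∏ p ∈ n.primeFactors, (if p < N then L else 1) * ((p : ℝ) ^ n.factorization p) ^ δ :=
        Finset.prod_le_prod (fun _ _ ↦ by positivity) fun p hp ↦
          hlocal p (Nat.prime_of_mem_primeFactors hp) _
    _ = L ^ (n.primeFactors.filter (· < N)).card * (n : ℝ) ^ δ := by
        rw [Finset.prod_mul_distrib, hnp, ← Finset.prod_filter, Finset.prod_const]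
    _ ≤ L ^ N * (n : ℝ) ^ δ := by
        gcongr
        calc _ ≤ (Finset.range N).card := Finset.card_le_card fun p hp ↦ by
              simpa using (Finset.mem_filter.1 hp).2
          _ = N := Finset.card_range N

theorem two_mul_le_of_pell_four {D p q p' q' : ℤ} (h : p ^ 2 - D * q ^ 2 = 4)
    (h' : p' ^ 2 - D * q' ^ 2 = 4) (hD : D ≠ 0) (hq : 0 < q) (hqq : q < q') : 2 * q ≤ q' := by
  rcases lt_or_gt_of_ne hD with hD | hD
  · have : q' ^ 2 ≤ 4 := by nlinarith [sq_nonneg p', sq_nonneg q']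
    have : q' ≤ 2 := by nlinarith
    lia
  wlog hp : 0 ≤ p generalizing p
  · exact this (p := -p) (by linarith [neg_sq p]) (by lia)
  wlog hp' : 0 ≤ p' generalizing p'
  · exact this (p' := -p') (by linarith [neg_sq p']) (by lia)
  have hq' : 0 < q' := hq.trans hqq
  have hpq : q < p := lt_of_pow_lt_pow_left₀ 2 hp (by nlinarith [sq_nonneg q])
  have hparity : ∀ {r s : ℤ}, r ^ 2 - D * s ^ 2 = 4 → ∃ k, r = D * s + 2 * k := by
    intro r s hrs
    have : Even (r - D * s) := by
      have h4 : Even (r ^ 2 - D * s ^ 2) := by rw [hrs]; decide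
      simpa [Int.even_sub, Int.even_mul, Int.even_pow] using h4
    obtain ⟨k, hk⟩ := this
    exact ⟨k, by linarith⟩
  obtain ⟨k, hk⟩ := hparity h
  obtain ⟨k', hk'⟩ := hparity h'
  obtain ⟨v, hv⟩ : ∃ v, p * q' - p' * q = 2 * v := ⟨k * q' - k' * q, by rw [hk, hk']; ring⟩
  have hDD : Even (D * D - D) := by
    simp [Int.even_sub, Int.even_mul]
  obtain ⟨j, hj⟩ := hDD
  obtain ⟨u, hu⟩ : ∃ u, p * p' - D * q * q' = 2 * u :=
    ⟨j * q * q' + D * q * k' + k * D * q' + 2 * k * k', by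
      rw [hk, hk']; linear_combination q * q' * hj⟩
  have hqv : p * v + q * u = 2 * q' := by
    have : 2 * (p * v + q * u) = 2 * (2 * q') := by
      linear_combination (-p) * hv - q * hu + q' * h
    linarith
  have huv : u ^ 2 - D * v ^ 2 = 4 := by
    have : 4 * (u ^ 2 - D * v ^ 2) = 4 * 4 := by
      have : (2 * u) ^ 2 - D * (2 * v) ^ 2 = 16 := by
        rw [← hu, ← hv]
        linear_combination (p' ^ 2 - D * q' ^ 2) * h + 4 * h'
      linarith
    linarith
  have hv0 : 0 < v := by
    have : p' * q < p * q' := lt_of_pow_lt_pow_left₀ 2 (by positivity) (by nlinarith)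
    lia
  have hu0 : 0 < u := by
    have h1 : D * q * q' < p * p' := by
      refine lt_of_pow_lt_pow_left₀ 2 (by positivity) ?_
      have e1 : p ^ 2 = 4 + D * q ^ 2 := by linarith
      have e2 : p' ^ 2 = 4 + D * q' ^ 2 := by linarith
      rw [mul_pow, mul_pow, mul_pow, e1, e2]
      nlinarith [mul_pos hD (pow_pos hq 2), mul_pos hD (pow_pos (hq.trans hqq) 2)]
    lia
  have hu3 : 3 ≤ u := by
    have : 4 < u ^ 2 := by nlinarith [mul_pos hD (pow_pos hv0 2)]
    nlinarith
  nlinarith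

theorem card_pell_four_le {D : ℤ} (hD : D ≠ 0) (B : ℕ) (T : Finset (ℤ × ℤ))
    (hT : ∀ s ∈ T, s.1 ^ 2 - D * s.2 ^ 2 = 4 ∧ s.2.natAbs ≤ B) :
    T.card ≤ 9 * (Nat.log 2 B + 1) := by
  let S : Finset ℤ := {-1, 0, 1}
  have hS : ∀ z : ℤ, z.sign ∈ S := fun z ↦ by
    rcases Int.sign_trichotomy z with h | h | h <;> simp [S, h]
  have key : T.card ≤ ((S ×ˢ S) ×ˢ Finset.range (Nat.log 2 B + 1)).card := by
    refine Finset.card_le_card_of_injOn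
      (fun s ↦ ((s.1.sign, s.2.sign), Nat.log 2 s.2.natAbs)) ?_ ?_
    · intro s hs
      have := Nat.log_mono_right (b := 2) (hT s hs).2
      simp only [Finset.coe_product, Set.mem_prod, Finset.mem_coe, hS, Finset.mem_range, true_and]
      lia
    · rintro ⟨p, q⟩ hs ⟨p', q'⟩ hs' heq
      simp only [Prod.mk.injEq] at heq
      obtain ⟨⟨hp, hq⟩, hl⟩ := heq
      have h1 := (hT _ hs).1
      have h2 := (hT _ hs').1
      simp only at h1 h2
      have aux : ∀ {r s r' s' : ℤ}, r ^ 2 - D * s ^ 2 = 4 → r' ^ 2 - D * s' ^ 2 = 4 → s ≠ 0 →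
          Nat.log 2 s.natAbs = Nat.log 2 s'.natAbs → ¬ s.natAbs < s'.natAbs := by
        intro r s r' s' e e' hs0 hlog hlt
        have h := two_mul_le_of_pell_four (p := r) (p' := r') (q := s.natAbs) (q' := s'.natAbs)
          (by rwa [Int.natAbs_sq]) (by rwa [Int.natAbs_sq]) hD (by lia) (by lia)
        have h' : s.natAbs * 2 ≤ s'.natAbs := by lia
        have := Nat.log_mono_right (b := 2) h'
        rw [Nat.log_mul_base one_lt_two (by lia)] at this
        lia
      have habs : q.natAbs = q'.natAbs := by
        by_cases hq0 : q = 0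
        · have : q'.sign = 0 := by rw [← hq, hq0]; rfl
          rw [hq0, Int.sign_eq_zero_iff_zero.1 this]
        · have hq0' : q' ≠ 0 := fun h ↦ hq0 (Int.sign_eq_zero_iff_zero.1 (by rw [hq, h]; rfl))
          exact le_antisymm (not_lt.1 (aux h2 h1 hq0' hl.symm)) (not_lt.1 (aux h1 h2 hq0 hl))
      have hqq : q = q' := by
        rw [← Int.sign_mul_natAbs q, ← Int.sign_mul_natAbs q', hq, habs]
      have hpp : p.natAbs = p'.natAbs := by
        rw [Int.natAbs_eq_iff_sq_eq]
        subst hqq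
        linarith
      have : p = p' := by
        rw [← Int.sign_mul_natAbs p, ← Int.sign_mul_natAbs p', hp, hpp]
      rw [this, hqq]
  refine key.trans ?_
  rw [Finset.card_product, Finset.card_product, Finset.card_range]
  exact Nat.mul_le_mul_right _ (by decide)

/-- Solutions of `Y² - D X² = M` whose pairwise determinants are divisible by `M`, up to a factor
`2`, differ multiplicatively by solutions of `p² - D q² = 4`. -/
theorem card_norm_eq_le_of_dvd {D M : ℤ} (hD : D ≠ 0) (hM : M ≠ 0) (B : ℕ) (T : Finset (ℤ × ℤ))
    (hT : ∀ s ∈ T, s.1 ^ 2 - D * s.2 ^ 2 = M ∧ s.1.natAbs ≤ B ∧ s.2.natAbs ≤ B)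
    (hdvd : ∀ s ∈ T, ∀ t ∈ T, M ∣ 2 * (s.1 * t.2 - s.2 * t.1)) :
    T.card ≤ 9 * (Nat.log 2 (4 * B ^ 2) + 1) := by
  rcases T.eq_empty_or_nonempty with rfl | ⟨⟨y', x'⟩, ht⟩
  · simp
  obtain ⟨ht1, ht2, ht3⟩ := hT _ ht
  simp only at ht1 ht2 ht3
  have hu : ∀ s ∈ T, M ∣ 2 * (s.1 * y' - D * s.2 * x') := by
    rintro ⟨y, x⟩ hs
    have h1 := (hT _ hs).1
    obtain ⟨k, hk⟩ := hdvd _ hs _ ht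
    simp only at h1 hk ⊢
    rw [← Int.pow_dvd_pow_iff two_ne_zero]
    refine ⟨4 + D * k ^ 2, ?_⟩
    have : (2 * (y * y' - D * x * x')) ^ 2 - D * (2 * (y * x' - x * y')) ^ 2 = 4 * M ^ 2 := by
      linear_combination 4 * (y' ^ 2 - D * x' ^ 2) * h1 + 4 * M * ht1
    rw [hk] at this
    linear_combination this
  let φ : ℤ × ℤ → ℤ × ℤ := fun s ↦
    (2 * (s.1 * y' - D * s.2 * x') / M, 2 * (s.1 * x' - s.2 * y') / M)
  have hφ1 : ∀ s ∈ T, M * (φ s).1 = 2 * (s.1 * y' - D * s.2 * x') := fun s hs ↦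
    Int.mul_ediv_cancel' (hu s hs)
  have hφ2 : ∀ s ∈ T, M * (φ s).2 = 2 * (s.1 * x' - s.2 * y') := fun s hs ↦
    Int.mul_ediv_cancel' (hdvd s hs _ ht)
  have hinj : Set.InjOn φ T := by
    rintro ⟨y, x⟩ hs ⟨z, w⟩ hs' heq
    have e1 := hφ1 _ hs
    have e2 := hφ2 _ hs
    rw [heq, hφ1 _ hs'] at e1
    rw [heq, hφ2 _ hs'] at e2
    simp only at e1 e2
    have hy : 2 * M * (y - z) = 0 := by
      linear_combination (-2 * (y - z)) * ht1 - y' * e1 + D * x' * e2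
    have hx : 2 * M * (x - w) = 0 := by
      linear_combination (-2 * (x - w)) * ht1 - x' * e1 + y' * e2
    have h2M : 2 * M ≠ 0 := mul_ne_zero two_ne_zero hM
    have := (mul_eq_zero.1 hy).resolve_left h2M
    have := (mul_eq_zero.1 hx).resolve_left h2M
    ext <;> simp only <;> lia
  rw [← Finset.card_image_of_injOn hinj]
  refine card_pell_four_le hD _ _ fun r hr ↦ ?_
  obtain ⟨⟨y, x⟩, hs, rfl⟩ := Finset.mem_image.1 hr
  have e1 := hφ1 _ hs
  have e2 := hφ2 _ hs
  obtain ⟨h1, h2, h3⟩ := hT _ hs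
  simp only at e1 e2 h1 h2 h3
  constructor
  · have hM2 : M ^ 2 ≠ 0 := pow_ne_zero 2 hM
    apply mul_left_cancel₀ hM2
    calc M ^ 2 * ((φ (y, x)).1 ^ 2 - D * (φ (y, x)).2 ^ 2)
        = (M * (φ (y, x)).1) ^ 2 - D * (M * (φ (y, x)).2) ^ 2 := by ring
      _ = M ^ 2 * 4 := by
        rw [e1, e2]
        linear_combination 4 * (y' ^ 2 - D * x' ^ 2) * h1 + 4 * M * ht1
  · calc (φ (y, x)).2.natAbs ≤ M.natAbs * (φ (y, x)).2.natAbs :=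
          Nat.le_mul_of_pos_left _ (Int.natAbs_pos.2 hM)
      _ = 2 * (y * x' - x * y').natAbs := by rw [← Int.natAbs_mul, e2, Int.natAbs_mul]; rfl
      _ ≤ 2 * (y.natAbs * x'.natAbs + x.natAbs * y'.natAbs) := by
          rw [← Int.natAbs_mul, ← Int.natAbs_mul]
          gcongr
          exact Int.natAbs_sub_le _ _
      _ ≤ 2 * (B * B + B * B) := by gcongr
      _ = 4 * B ^ 2 := by ring

theorem isCoprime_of_norm_eq {D M x y : ℤ} (h : y ^ 2 - D * x ^ 2 = M) (hxy : IsCoprime y x) :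
    IsCoprime x M := by
  have : IsCoprime x (y ^ 2) := hxy.symm.pow_right
  rw [← h]
  have h2 := this.add_mul_left_right (-(D * x))
  rwa [show y ^ 2 + x * -(D * x) = y ^ 2 - D * x ^ 2 by ring] at h2

theorem card_primitive_norm_eq_le {D M : ℤ} (hD : D ≠ 0) (hM : M ≠ 0)
    (hsq : ∀ t : ℤ, t ^ 2 ∣ D → t ^ 2 ∣ M → IsUnit t) (B : ℕ) (T : Finset (ℤ × ℤ))
    (hT : ∀ s ∈ T, s.1 ^ 2 - D * s.2 ^ 2 = M ∧ s.1.natAbs ≤ B ∧ s.2.natAbs ≤ B)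
    (hcop : ∀ s ∈ T, IsCoprime s.1 s.2) :
    T.card ≤ 9 * (Nat.log 2 (4 * B ^ 2) + 1) * M.natAbs.divisors.card := by
  rcases T.eq_empty_or_nonempty with rfl | ⟨⟨y₀, x₀⟩, h₀⟩
  · simp
  have e₀ := (hT _ h₀).1
  have hx₀ := isCoprime_of_norm_eq e₀ (hcop _ h₀)
  simp only at e₀ hx₀
  refine Finset.card_le_mul_card_image_of_maps_to
    (f := fun s ↦ Int.gcd (s.1 * x₀ - s.2 * y₀) M) (fun s _ ↦ ?_) _ fun g hg ↦ ?_
  · simpa [Nat.mem_divisors, hM] using Int.natAbs_dvd_natAbs.2 (Int.gcd_dvd_right _ _)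
  · refine card_norm_eq_le_of_dvd hD hM B _ (fun s hs ↦ hT s (Finset.mem_filter.1 hs).1) ?_
    have hgM : (g : ℤ) ∣ M := Int.natCast_dvd.2 (Nat.mem_divisors.1 hg).1
    obtain ⟨m, hm⟩ := hgM
    have hg0 : (g : ℤ) ≠ 0 := by rintro h; simp [h] at hm; exact hM hm
    have hboth : ∀ s ∈ T, Int.gcd (s.1 * x₀ - s.2 * y₀) M = g →
        (g : ℤ) ∣ s.1 * x₀ - s.2 * y₀ ∧ m ∣ s.1 * x₀ + s.2 * y₀ := by
      rintro ⟨y, x⟩ hs hgs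
      have e := (hT _ hs).1
      simp only at e hgs ⊢
      refine ⟨hgs ▸ Int.gcd_dvd_left _ _, ?_⟩
      have hgl : (g : ℤ) ∣ y * x₀ - x * y₀ := hgs ▸ Int.gcd_dvd_left _ _
      obtain ⟨w, hw⟩ := hgl
      have hcw : IsCoprime m w := by
        have h1 : Int.gcd w m = 1 := by
          rw [hw, hm, Int.gcd_mul_left] at hgs
          have : g * Int.gcd w m = g * 1 := by simpa using hgs
          exact Nat.eq_of_mul_eq_mul_left (by lia) this
        exact (Int.isCoprime_iff_gcd_eq_one.2 h1).symm
      refine hcw.dvd_of_dvd_mul_left ⟨x₀ ^ 2 - x ^ 2, ?_⟩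
      apply mul_left_cancel₀ hg0
      calc (g : ℤ) * (w * (y * x₀ + x * y₀)) = (y * x₀ - x * y₀) * (y * x₀ + x * y₀) := by
            rw [hw]; ring
        _ = M * (x₀ ^ 2 - x ^ 2) := by linear_combination x₀ ^ 2 * e - x ^ 2 * e₀
        _ = _ := by rw [hm]; ring
    rintro ⟨y, x⟩ hs ⟨y', x'⟩ hs'
    rw [Finset.mem_filter] at hs hs'
    obtain ⟨hg1, hm1⟩ := hboth _ hs.1 hs.2
    obtain ⟨hg2, hm2⟩ := hboth _ hs'.1 hs'.2
    have e := (hT _ hs.1).1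
    have hx := isCoprime_of_norm_eq e (hcop _ hs.1)
    simp only at hg1 hm1 hg2 hm2 e hx ⊢
    have hgM : (g : ℤ) ∣ M := ⟨m, hm⟩
    have hmM : m ∣ M := ⟨g, by rw [hm, mul_comm]⟩
    have hgv : (g : ℤ) ∣ y * x' - x * y' := by
      refine (hx₀.of_isCoprime_of_dvd_right hgM).symm.dvd_of_dvd_mul_left ?_
      convert dvd_sub (hg1.mul_left x') (hg2.mul_left x) using 1
      ring
    have hmv : m ∣ y * x' - x * y' := by
      refine (hx₀.of_isCoprime_of_dvd_right hmM).symm.dvd_of_dvd_mul_left ?_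
      convert dvd_sub (hm1.mul_left x') (hm2.mul_left x) using 1
      ring
    have ht2 : (Int.gcd g m : ℤ) ∣ 2 := by
      set t : ℤ := (Int.gcd g m : ℤ) with ht
      have htg : t ∣ g := Int.gcd_dvd_left _ _
      have htm : t ∣ m := Int.gcd_dvd_right _ _
      have htM : t ^ 2 ∣ M := by rw [hm, sq]; exact mul_dvd_mul htg htm
      have htc₀ : IsCoprime t x₀ := (hx₀.of_isCoprime_of_dvd_right (htg.trans hgM)).symm
      have htc : IsCoprime t x := (hx.of_isCoprime_of_dvd_right (htg.trans hgM)).symm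
      have ht2y : t ∣ 2 * y := by
        refine htc₀.dvd_of_dvd_mul_left ?_
        convert dvd_add (htg.trans hg1) (htm.trans hm1) using 1
        ring
      have ht4D : t ^ 2 ∣ 4 * D := by
        refine (htc.pow (m := 2) (n := 2)).dvd_of_dvd_mul_right ?_
        have h1 : t ^ 2 ∣ (2 * y) ^ 2 := pow_dvd_pow_of_dvd ht2y 2
        convert dvd_sub h1 (htM.mul_left 4) using 1
        linear_combination -4 * e
      rcases Int.even_or_odd t with hev | hodd
      · obtain ⟨r, hr⟩ := hev.two_dvd
        have h4 : t ^ 2 = 4 * r ^ 2 := by rw [hr]; ring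
        rw [h4] at ht4D htM
        have hru := hsq r ((mul_dvd_mul_iff_left (by norm_num)).1 ht4D)
          ((Dvd.intro_left _ rfl).trans htM)
        rw [hr]
        simpa using mul_dvd_mul_left 2 (hru.dvd : r ∣ 1)
      · have hc2 : IsCoprime t 2 := by
          rw [Int.isCoprime_iff_gcd_eq_one, Int.gcd_comm]
          exact Int.isCoprime_iff_gcd_eq_one.1 ((Int.isCoprime_two_left).2 hodd)
        have hc4 : IsCoprime (t ^ 2) 4 := by
          have := hc2.pow (m := 2) (n := 2)
          norm_num at this ⊢
          exact this
        exact (hsq t (hc4.dvd_of_dvd_mul_left ht4D) htM).dvd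
    rw [hm]
    have hl : (Int.lcm g m : ℤ) ∣ y * x' - x * y' := Int.coe_lcm_dvd hgv hmv
    have hgl : (Int.gcd g m : ℤ) * (Int.lcm g m : ℤ) ∣ 2 * (y * x' - x * y') :=
      mul_dvd_mul ht2 hl
    refine dvd_trans ?_ hgl
    rw [← Int.natCast_mul, Int.gcd_mul_lcm]
    rw [← Int.natAbs_mul]
    exact Int.dvd_natAbs_self

theorem card_norm_eq_le_of_squarefree_gcd {D M : ℤ} (hD : D ≠ 0) (hM : M ≠ 0)
    (hsq : ∀ t : ℤ, t ^ 2 ∣ D → t ^ 2 ∣ M → IsUnit t) (B : ℕ) (T : Finset (ℤ × ℤ))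
    (hT : ∀ s ∈ T, s.1 ^ 2 - D * s.2 ^ 2 = M ∧ s.1.natAbs ≤ B ∧ s.2.natAbs ≤ B) :
    T.card ≤ 9 * (Nat.log 2 (4 * B ^ 2) + 1) * M.natAbs.divisors.card *
      M.natAbs.divisors.card := by
  have hsqM : ∀ s ∈ T, (Int.gcd s.1 s.2 : ℤ) ^ 2 ∣ M := fun s hs ↦ by
    rw [← (hT s hs).1]
    exact dvd_sub (pow_dvd_pow_of_dvd (Int.gcd_dvd_left _ _) 2)
      ((pow_dvd_pow_of_dvd (Int.gcd_dvd_right _ _) 2).mul_left D)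
  refine Finset.card_le_mul_card_image_of_maps_to (f := fun s ↦ Int.gcd s.1 s.2)
    (fun s hs ↦ ?_) _ fun h _ ↦ ?_
  · simpa [Nat.mem_divisors, hM] using
      Int.natCast_dvd.1 ((dvd_pow_self _ two_ne_zero).trans (hsqM s hs))
  rcases (T.filter fun s ↦ Int.gcd s.1 s.2 = h).eq_empty_or_nonempty with hE | ⟨s₀, hs₀⟩
  · rw [hE]; simp
  obtain ⟨hs₀T, hs₀h⟩ := Finset.mem_filter.1 hs₀
  obtain ⟨M', hM'⟩ := hsqM s₀ hs₀T
  rw [hs₀h] at hM'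
  have hh0 : (h : ℤ) ≠ 0 := by rintro h0; simp [h0] at hM'; exact hM hM'
  have hM'0 : M' ≠ 0 := by rintro rfl; simp at hM'; exact hM hM'
  let φ : ℤ × ℤ → ℤ × ℤ := fun s ↦ (s.1 / h, s.2 / h)
  have hφ : ∀ s ∈ T.filter fun s ↦ Int.gcd s.1 s.2 = h,
      s.1 = h * (φ s).1 ∧ s.2 = h * (φ s).2 := fun s hs ↦ by
    have := (Finset.mem_filter.1 hs).2
    exact ⟨(Int.mul_ediv_cancel' (this ▸ Int.gcd_dvd_left _ _)).symm,
      (Int.mul_ediv_cancel' (this ▸ Int.gcd_dvd_right _ _)).symm⟩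
  have hinj : Set.InjOn φ (T.filter fun s ↦ Int.gcd s.1 s.2 = h) := fun s hs s' hs' heq ↦ by
    obtain ⟨h1, h2⟩ := hφ s hs
    obtain ⟨h3, h4⟩ := hφ s' hs'
    rw [heq] at h1 h2
    exact Prod.ext (h1.trans h3.symm) (h2.trans h4.symm)
  rw [← Finset.card_image_of_injOn hinj]
  have hle : M'.natAbs.divisors.card ≤ M.natAbs.divisors.card :=
    Finset.card_le_card (Nat.divisors_subset_of_dvd (by simpa using hM)
      (Int.natAbs_dvd_natAbs.2 ⟨(h : ℤ) ^ 2, by rw [hM', mul_comm]⟩))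
  refine (card_primitive_norm_eq_le hD hM'0
    (fun t h1 h2 ↦ hsq t h1 (h2.trans ⟨(h : ℤ) ^ 2, by rw [hM', mul_comm]⟩)) B _
    (fun r hr ↦ ?_) (fun r hr ↦ ?_)).trans (Nat.mul_le_mul_left _ hle)
  all_goals
    obtain ⟨s, hs, rfl⟩ := Finset.mem_image.1 hr
    obtain ⟨h1, h2⟩ := hφ s hs
    obtain ⟨hsT, hsh⟩ := Finset.mem_filter.1 hs
  · obtain ⟨e, b1, b2⟩ := hT s hsT
    refine ⟨?_, le_trans ?_ b1, le_trans ?_ b2⟩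
    · apply mul_left_cancel₀ (pow_ne_zero 2 hh0)
      rw [h1, h2, hM'] at e
      linear_combination e
    · conv_rhs => rw [h1, Int.natAbs_mul]
      exact Nat.le_mul_of_pos_left _ (by lia)
    · conv_rhs => rw [h2, Int.natAbs_mul]
      exact Nat.le_mul_of_pos_left _ (by lia)
  · rw [h1, h2, Int.gcd_mul_left] at hsh
    rw [Int.isCoprime_iff_gcd_eq_one]
    exact Nat.eq_of_mul_eq_mul_left (by lia : 0 < h) (by simpa using hsh)

/-- The number of integer points on `Y² - D X² = M` in a box of size `B`. -/
theorem card_norm_eq_le {D M : ℤ} (hD : D ≠ 0) (hM : M ≠ 0) (B : ℕ) (T : Finset (ℤ × ℤ))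
    (hT : ∀ s ∈ T, s.1 ^ 2 - D * s.2 ^ 2 = M ∧ s.1.natAbs ≤ B ∧ s.2.natAbs ≤ B) :
    T.card ≤ 9 * (Nat.log 2 (4 * B ^ 2) + 1) * M.natAbs.divisors.card *
      M.natAbs.divisors.card := by
  induction hn : M.natAbs using Nat.strong_induction_on generalizing D M T with
  | _ n ih =>
  subst hn
  by_cases hsq : ∀ t : ℤ, t ^ 2 ∣ D → t ^ 2 ∣ M → IsUnit t
  · exact card_norm_eq_le_of_squarefree_gcd hD hM hsq B T hT
  push Not at hsq
  obtain ⟨t, ⟨D', hD'⟩, ⟨M', hM'⟩, htu⟩ := hsq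
  have ht0 : t ≠ 0 := by rintro rfl; simp at hM'; exact hM hM'
  have hD'0 : D' ≠ 0 := by rintro rfl; simp at hD'; exact hD hD'
  have hM'0 : M' ≠ 0 := by rintro rfl; simp at hM'; exact hM hM'
  have ht1 : 1 < t.natAbs := by
    rw [Int.isUnit_iff_natAbs_eq] at htu
    lia
  have hdvd : M'.natAbs ∣ M.natAbs :=
    Int.natAbs_dvd_natAbs.2 ⟨t ^ 2, by rw [hM', mul_comm]⟩
  have hlt : M'.natAbs < M.natAbs := by
    rw [hM', Int.natAbs_mul, Int.natAbs_pow]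
    exact lt_mul_left (Int.natAbs_pos.2 hM'0) (Nat.one_lt_pow two_ne_zero ht1)
  have hle : M'.natAbs.divisors.card ≤ M.natAbs.divisors.card :=
    Finset.card_le_card (Nat.divisors_subset_of_dvd (by simpa using hM) hdvd)
  let φ : ℤ × ℤ → ℤ × ℤ := fun s ↦ (s.1 / t, s.2)
  have hφ : ∀ s ∈ T, s.1 = t * (φ s).1 := fun s hs ↦ by
    refine (Int.mul_ediv_cancel' ?_).symm
    rw [← Int.pow_dvd_pow_iff two_ne_zero]
    refine ⟨M' + D' * s.2 ^ 2, ?_⟩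
    have := (hT s hs).1
    rw [hM', hD'] at this
    linear_combination this
  have hinj : Set.InjOn φ T := fun s hs s' hs' heq ↦ by
    refine Prod.ext ?_ (Prod.ext_iff.1 heq).2
    rw [hφ s hs, hφ s' hs', heq]
  rw [← Finset.card_image_of_injOn hinj]
  refine (ih _ hlt hD'0 hM'0 _ (fun r hr ↦ ?_) rfl).trans
    (Nat.mul_le_mul (Nat.mul_le_mul_left _ hle) hle)
  obtain ⟨s, hs, rfl⟩ := Finset.mem_image.1 hr
  have h1 := hφ s hs
  obtain ⟨e, b1, b2⟩ := hT s hs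
  refine ⟨?_, le_trans ?_ b1, b2⟩
  · apply mul_left_cancel₀ (pow_ne_zero 2 ht0)
    rw [hD', hM', h1] at e
    linear_combination e
  · conv_rhs => rw [h1, Int.natAbs_mul]
    exact Nat.le_mul_of_pos_left _ (by lia)

theorem abs_mul_le_mul {x y A B : ℝ} (hx : |x| ≤ A) (hy : |y| ≤ B) : |x * y| ≤ A * B := by
  rw [abs_mul]
  exact mul_le_mul hx hy (abs_nonneg _) ((abs_nonneg _).trans hx)

/-- Completing the square turns the integer points of the conic into solutions of
`Y² + Δ X² = -4 a Θ`. -/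
theorem card_conic_le (P Q : ℝ) (a b c d e f : ℤ) (hP : 2 ≤ P) (hQ : 2 ≤ Q)
    (ha : (|a| : ℝ) ≤ Q) (hb : (|b| : ℝ) ≤ Q) (hc : (|c| : ℝ) ≤ Q)
    (hd : (|d| : ℝ) ≤ Q) (he : (|e| : ℝ) ≤ Q) (ha0 : a ≠ 0) (hΔ : 4 * a * c - b ^ 2 ≠ 0)
    (hΘ : 4 * a * c * f + e * b * d - a * e ^ 2 - c * d ^ 2 - f * b ^ 2 ≠ 0)
    (M : ℤ) (hM : M = -4 * a *
      (4 * a * c * f + e * b * d - a * e ^ 2 - c * d ^ 2 - f * b ^ 2)) :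
    Nat.card {xy : ℤ × ℤ // (|xy.1| : ℝ) ≤ P ∧ (|xy.2| : ℝ) ≤ P ∧
        a * xy.1 ^ 2 + b * xy.1 * xy.2 + c * xy.2 ^ 2 + d * xy.1 + e * xy.2 + f = 0} ≤
      9 * (Nat.log 2 (4 * ⌊8 * Q ^ 2 * P⌋₊ ^ 2) + 1) * M.natAbs.divisors.card *
        M.natAbs.divisors.card := by
  set B := ⌊8 * Q ^ 2 * P⌋₊ with hB
  have hM0 : M ≠ 0 := by
    rw [hM]
    exact mul_ne_zero (mul_ne_zero (by norm_num) ha0) hΘ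
  let T : Finset (ℤ × ℤ) := (Finset.Icc (-B : ℤ) B ×ˢ Finset.Icc (-B : ℤ) B).filter
    fun s ↦ s.1 ^ 2 - (-(4 * a * c - b ^ 2)) * s.2 ^ 2 = M
  refine le_trans ?_ (card_norm_eq_le (neg_ne_zero.2 hΔ) hM0 B T fun s hs ↦ ?_)
  swap
  · simp only [T, Finset.mem_filter, Finset.mem_product, Finset.mem_Icc] at hs
    exact ⟨hs.2, by lia, by lia⟩
  have hbound : ∀ z : ℤ, |(z : ℝ)| ≤ 8 * Q ^ 2 * P → z ∈ Finset.Icc (-B : ℤ) B := by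
    intro z hz
    have : z.natAbs ≤ B := Nat.le_floor (by rwa [Nat.cast_natAbs, Int.cast_abs])
    rw [Finset.mem_Icc]
    lia
  rw [← Fintype.card_coe T, ← Nat.card_eq_fintype_card]
  refine Nat.card_le_card_of_injective (fun xy ↦ (⟨((4 * a * c - b ^ 2) * xy.1.2 +
    2 * a * e - b * d, 2 * a * xy.1.1 + b * xy.1.2 + d), ?_⟩ : T)) ?_
  · obtain ⟨⟨x, y⟩, hx, hy, hxy⟩ := xy
    simp only at hx hy hxy ⊢
    simp only [T, Finset.mem_filter, Finset.mem_product]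
    have hQ0 : 0 ≤ Q := by linarith
    have h4 : |(4 : ℝ)| ≤ 4 := by norm_num
    have h2 : |(2 : ℝ)| ≤ 2 := by norm_num
    have hQQ : 0 ≤ Q * (Q - 2) := mul_nonneg hQ0 (by linarith)
    have hQP : 0 ≤ Q * (P - 2) := mul_nonneg hQ0 (by linarith)
    have hQQP : 0 ≤ Q ^ 2 * (P - 2) := mul_nonneg (by positivity) (by linarith)
    have hQPQ : 0 ≤ P * (Q * (Q - 2)) := mul_nonneg (by linarith) hQQ
    refine ⟨⟨hbound _ ?_, hbound _ ?_⟩, ?_⟩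
    · push_cast
      have h1 : |((4 * a * c - b ^ 2) * y : ℝ)| ≤ (4 * Q * Q + Q ^ 2) * P := by
        refine abs_mul_le_mul ((abs_sub _ _).trans (add_le_add
          (abs_mul_le_mul (abs_mul_le_mul h4 ha) hc) ?_)) hy
        rw [abs_pow]
        gcongr
      have h3 := abs_mul_le_mul (abs_mul_le_mul h2 ha) he
      have h5 := abs_mul_le_mul hb hd
      refine (abs_sub _ _).trans ?_
      have := abs_add_le ((4 * a * c - b ^ 2) * y : ℝ) (2 * a * e)
      nlinarith
    · push_cast
      have h3 := abs_mul_le_mul (abs_mul_le_mul h2 ha) hx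
      have h5 := abs_mul_le_mul hb hy
      have h6 := abs_add_le (2 * a * x + b * y : ℝ) d
      have h7 := abs_add_le (2 * a * x : ℝ) (b * y)
      nlinarith
    · rw [hM]
      linear_combination 4 * a * (4 * a * c - b ^ 2) * hxy
  · rintro ⟨⟨x, y⟩, h⟩ ⟨⟨x', y'⟩, h'⟩ heq
    simp only [Subtype.mk.injEq, Prod.mk.injEq] at heq ⊢
    obtain ⟨h1, h2⟩ := heq
    have hy : y = y' := mul_left_cancel₀ hΔ (by linarith)
    subst hy
    exact ⟨mul_left_cancel₀ (mul_ne_zero two_ne_zero ha0) (by linarith), rfl⟩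

theorem exists_card_conic_le_rpow (ε : ℝ) (hε : 0 < ε) :
    ∃ K : ℝ, ∀ (P Q : ℝ) (a b c d e f : ℤ), 2 ≤ P → 2 ≤ Q →
      (|a| : ℝ) ≤ Q → (|b| : ℝ) ≤ Q → (|c| : ℝ) ≤ Q →
      (|d| : ℝ) ≤ Q → (|e| : ℝ) ≤ Q → (|f| : ℝ) ≤ Q →
      a ≠ 0 → 4 * a * c - b ^ 2 ≠ 0 →
        4 * a * c * f + e * b * d - a * e ^ 2 - c * d ^ 2 - f * b ^ 2 ≠ 0 →
      (Nat.card {xy : ℤ × ℤ // (|xy.1| : ℝ) ≤ P ∧ (|xy.2| : ℝ) ≤ P ∧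
          a * xy.1 ^ 2 + b * xy.1 * xy.2 + c * xy.2 ^ 2 + d * xy.1 + e * xy.2 + f = 0} : ℝ)
        ≤ K * (P * Q) ^ ε := by
  obtain ⟨C, hC1, hC⟩ := Nat.exists_card_divisors_le_rpow (ε / 19) (by positivity)
  refine ⟨9 * C ^ 3, fun P Q a b c d e f hP hQ ha hb hc hd he hf ha0 hΔ hΘ ↦ ?_⟩
  set δ := ε / 19 with hδ
  have hδ0 : 0 < δ := by positivity
  set M : ℤ := -4 * a * (4 * a * c * f + e * b * d - a * e ^ 2 - c * d ^ 2 - f * b ^ 2) with hM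
  have hM0 : M ≠ 0 := mul_ne_zero (mul_ne_zero (by norm_num) ha0) hΘ
  have hmain := card_conic_le P Q a b c d e f hP hQ ha hb hc hd he ha0 hΔ hΘ M hM
  set B := ⌊8 * Q ^ 2 * P⌋₊ with hB
  have hQ0 : 0 < Q := by linarith
  have hP0 : 0 < P := by linarith
  set Z := P * Q with hZ
  have hZ4 : 4 ≤ Z := by nlinarith
  have hZ0 : 0 < Z := by linarith
  have hMZ : (M.natAbs : ℝ) ≤ Z ^ 5 := by
    rw [Nat.cast_natAbs, Int.cast_abs, hM]
    push_cast
    have h4 : |(4 : ℝ)| ≤ 4 := by norm_num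
    have hn4 : |(-4 : ℝ)| ≤ 4 := by norm_num
    have hsq : ∀ {z : ℝ}, |z| ≤ Q → |z ^ 2| ≤ Q ^ 2 := fun {z} hz ↦ by
      rw [abs_pow]
      gcongr
    have h := abs_mul_le_mul (abs_mul_le_mul hn4 ha)
      ((abs_sub _ _).trans (add_le_add ((abs_sub _ _).trans (add_le_add ((abs_sub _ _).trans
        (add_le_add ((abs_add_le _ _).trans (add_le_add
          (abs_mul_le_mul (abs_mul_le_mul (abs_mul_le_mul h4 ha) hc) hf)
          (abs_mul_le_mul (abs_mul_le_mul he hb) hd)))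
        (abs_mul_le_mul ha (hsq he)))) (abs_mul_le_mul hc (hsq hd))))
        (abs_mul_le_mul hf (hsq hb))))
    refine h.trans ?_
    calc 4 * Q * (4 * Q * Q * Q + Q * Q * Q + Q * Q ^ 2 + Q * Q ^ 2 + Q * Q ^ 2)
        = 2 ^ 5 * Q ^ 4 := by ring
      _ ≤ P ^ 5 * Q ^ 5 := by
          gcongr
          · linarith
          · norm_num
      _ = Z ^ 5 := by rw [hZ, mul_pow]
  have hBZ : (B : ℝ) ≤ Z ^ 4 := by
    refine (Nat.floor_le (by positivity)).trans ?_
    calc 8 * Q ^ 2 * P = 2 ^ 3 * P * Q ^ 2 := by ring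
      _ ≤ P ^ 3 * P * Q ^ 4 := by
          gcongr
          · linarith
          · norm_num
      _ = Z ^ 4 := by rw [hZ]; ring
  have hB0 : B ≠ 0 := by
    refine (Nat.floor_pos.2 ?_).ne'
    nlinarith [mul_pos hQ0 hP0, mul_pos (mul_pos hQ0 hQ0) hP0]
  have hdiv : ∀ k n : ℕ, n ≠ 0 → (n : ℝ) ≤ Z ^ k →
      (n.divisors.card : ℝ) ≤ C * Z ^ (k * δ) := fun k n hn hnZ ↦ by
    refine (hC n hn).trans ?_
    rw [Real.rpow_mul hZ0.le, Real.rpow_natCast]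
    gcongr
  have hlog : ((Nat.log 2 (4 * B ^ 2) + 1 : ℕ) : ℝ) ≤ C * Z ^ ((9 : ℕ) * δ) := by
    have h1 : (2 ^ Nat.log 2 (4 * B ^ 2)).divisors.card = Nat.log 2 (4 * B ^ 2) + 1 := by
      rw [Nat.divisors_prime_pow Nat.prime_two, Finset.card_map, Finset.card_range]
    rw [← h1]
    refine hdiv 9 _ (by positivity) ?_
    calc ((2 ^ Nat.log 2 (4 * B ^ 2) : ℕ) : ℝ) ≤ ((4 * B ^ 2 : ℕ) : ℝ) := by
          exact_mod_cast Nat.pow_log_le_self 2 (by positivity)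
      _ = 4 * (B : ℝ) ^ 2 := by push_cast; ring
      _ ≤ Z * (Z ^ 4) ^ 2 := by gcongr
      _ = Z ^ 9 := by ring
  have hd5 := hdiv 5 M.natAbs (Int.natAbs_ne_zero.2 hM0) hMZ
  calc _ ≤ ((9 * (Nat.log 2 (4 * B ^ 2) + 1) * M.natAbs.divisors.card *
        M.natAbs.divisors.card : ℕ) : ℝ) := by exact_mod_cast hmain
    _ = 9 * ((Nat.log 2 (4 * B ^ 2) + 1 : ℕ) : ℝ) * M.natAbs.divisors.card *
        M.natAbs.divisors.card := by push_cast; ring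
    _ ≤ 9 * (C * Z ^ ((9 : ℕ) * δ)) * (C * Z ^ ((5 : ℕ) * δ)) * (C * Z ^ ((5 : ℕ) * δ)) := by
        gcongr
    _ = 9 * C ^ 3 * (Z ^ ((9 : ℕ) * δ) * Z ^ ((5 : ℕ) * δ) * Z ^ ((5 : ℕ) * δ)) := by ring
    _ = 9 * C ^ 3 * Z ^ ε := by
        rw [← Real.rpow_add hZ0, ← Real.rpow_add hZ0]
        congr 2
        rw [hδ]
        push_cast
        ring

/-- **Quadratic lemma, case (i).**
If `(a² + c²)·Δ·Θ ≠ 0`, then the number of integer solutions `(x,y)` of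
`ax² + bxy + cy² + dx + ey + f = 0` with `|x| ≤ P`, `|y| ≤ P` is `≪_ε (PQ)^ε`. -/
theorem quadratic_count_case_i (ε : ℝ) (hε : 0 < ε) :
    ∃ K : ℝ, ∀ (P Q : ℝ) (a b c d e f : ℤ), 2 ≤ P → 2 ≤ Q →
      (|a| : ℝ) ≤ Q → (|b| : ℝ) ≤ Q → (|c| : ℝ) ≤ Q →
      (|d| : ℝ) ≤ Q → (|e| : ℝ) ≤ Q → (|f| : ℝ) ≤ Q →
      (a ^ 2 + c ^ 2) * (4 * a * c - b ^ 2) *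
        (4 * a * c * f + e * b * d - a * e ^ 2 - c * d ^ 2 - f * b ^ 2) ≠ 0 →
      (Nat.card {xy : ℤ × ℤ // (|xy.1| : ℝ) ≤ P ∧ (|xy.2| : ℝ) ≤ P ∧
          a * xy.1 ^ 2 + b * xy.1 * xy.2 + c * xy.2 ^ 2 + d * xy.1 + e * xy.2 + f = 0} : ℝ)
        ≤ K * (P * Q) ^ ε := by
  obtain ⟨K, hK⟩ := exists_card_conic_le_rpow ε hε
  refine ⟨K, fun P Q a b c d e f hP hQ ha hb hc hd he hf h ↦ ?_⟩
  have hΘ := right_ne_zero_of_mul h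
  have hΔ := right_ne_zero_of_mul (left_ne_zero_of_mul h)
  have hac := left_ne_zero_of_mul (left_ne_zero_of_mul h)
  by_cases ha0 : a = 0
  · have hc0 : c ≠ 0 := by
      rintro rfl
      simp [ha0] at hac
    have hswap := hK P Q c b a e d f hP hQ hc hb ha he hd hf hc0
      (by convert hΔ using 1; ring) (by convert hΘ using 1; ring)
    rwa [Nat.card_congr ((Equiv.prodComm ℤ ℤ).subtypeEquiv fun xy ↦ ?_)] at hswap
    simp only [Equiv.prodComm_apply, Prod.fst_swap, Prod.snd_swap]
    rw [and_left_comm]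
    refine and_congr_right fun _ ↦ and_congr_right fun _ ↦ ?_
    ring_nf
  · exact hK P Q a b c d e f hP hQ ha hb hc hd he hf ha0 hΔ hΘ
end

section
/- Let s ≥ 3, k ∈ {3,4}, c a nonzero integer, and let 𝒞*(x₂,…,x_s) be an integral cubic form not of the shape a(b₂x₂+⋯+b_sx_s)³ for rationals a, b₂,…,b_s. Let 𝒫(x) = c·x₁^k + 𝒞*(x₂,…,x_s) and for a prime p let ρ_𝒫(p²) be the number of x ∈ (ℤ/p²ℤ)^s with 𝒫(x) ≡ 0 (mod p²). Then there is a constant C depending only on 𝒫 such that for all real X ≥ 2, |∏_{p > X} (1 − ρ_𝒫(p²)/p^{2s}) − 1| ≤ C/(X·log X), where the product is over primes p > X. -/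
open MvPolynomial

theorem ZMod.card_filter_castHom_eq_le {p : ℕ} [NeZero p] (b : ZMod p) :
    (Finset.univ.filter fun a : ZMod (p ^ 2) =>
      ZMod.castHom (dvd_pow_self p two_ne_zero) (ZMod p) a = b).card ≤ p := by
  have hp : 0 < p := Nat.pos_of_ne_zero (NeZero.ne p)
  conv_rhs => rw [← Finset.card_range p]
  refine Finset.card_le_card_of_injOn (fun a => a.val / p) ?_ ?_
  · intro a _
    have h : a.val < p ^ 2 := ZMod.val_lt a
    simp only [Finset.coe_range, Set.mem_Iio]
    exact Nat.div_lt_of_lt_mul (by rwa [← sq])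
  · intro a ha a' ha' h
    have ha := (Finset.mem_filter.1 (Finset.mem_coe.1 ha)).2
    have ha' := (Finset.mem_filter.1 (Finset.mem_coe.1 ha')).2
    rw [ZMod.castHom_apply] at ha ha'
    have h1 : ((a.val : ℕ) : ZMod p) = ((a'.val : ℕ) : ZMod p) := by
      rw [ZMod.natCast_val, ZMod.natCast_val, ha, ha']
    rw [ZMod.natCast_eq_natCast_iff'] at h1
    apply ZMod.val_injective
    rw [← Nat.div_add_mod a.val p, ← Nat.div_add_mod a'.val p, h1]
    simp only at h
    rw [h]

theorem ZMod.isUnit_of_castHom_ne_zero {p : ℕ} [Fact p.Prime] {a : ZMod (p ^ 2)}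
    (h : ZMod.castHom (dvd_pow_self p two_ne_zero) (ZMod p) a ≠ 0) : IsUnit a := by
  rw [← ZMod.natCast_zmod_val a, ZMod.isUnit_iff_coprime]
  refine Nat.Coprime.pow_right 2 ?_
  rw [Nat.coprime_comm, (Fact.out : p.Prime).coprime_iff_not_dvd, ← ZMod.natCast_eq_zero_iff,
    ZMod.natCast_val]
  exact h

open Classical in
theorem ZMod.card_filter_isUnit_pow_eq_le {p : ℕ} [Fact p.Prime] (hp2 : p ≠ 2) {k : ℕ}
    (hk : 0 < k) (u : ZMod (p ^ 2)) :
    (Finset.univ.filter fun x : ZMod (p ^ 2) => IsUnit x ∧ x ^ k = u).card ≤ k := by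
  have := ZMod.isCyclic_units_of_prime_pow p Fact.out hp2 2
  by_cases hne : ∃ x : (ZMod (p ^ 2))ˣ, (x : ZMod (p ^ 2)) ^ k = u
  · obtain ⟨x₀, hx₀⟩ := hne
    refine le_trans ?_ (IsCyclic.card_pow_eq_one_le (α := (ZMod (p ^ 2))ˣ) hk)
    refine le_trans (Finset.card_le_card ?_) (Finset.card_image_le
      (f := fun z : (ZMod (p ^ 2))ˣ => ((x₀ * z : (ZMod (p ^ 2))ˣ) : ZMod (p ^ 2))))
    intro x hx
    obtain ⟨-, ⟨y, rfl⟩, hy⟩ := Finset.mem_filter.1 hx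
    refine Finset.mem_image.2 ⟨x₀⁻¹ * y, ?_, by simp⟩
    have : y ^ k = x₀ ^ k := by
      ext
      simp [hy, hx₀]
    simp [mul_pow, this]
  · rw [Finset.card_eq_zero.2]
    · exact Nat.zero_le _
    · refine Finset.filter_eq_empty_iff.2 ?_
      rintro x - ⟨⟨y, rfl⟩, hy⟩
      exact hne ⟨y, hy⟩

theorem MvPolynomial.card_zeros_le {F : Type*} [Field F] [Fintype F] [DecidableEq F] {n d : ℕ}
    {f : MvPolynomial (Fin n) F} (hf : f ≠ 0) (hd : f.totalDegree ≤ d) :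
    (Finset.univ.filter fun y : Fin n → F => eval y f = 0).card * Fintype.card F ≤
      d * Fintype.card F ^ n := by
  have h := schwartz_zippel_totalDegree hf (Finset.univ : Finset F)
  have hq : (0 : ℚ≥0) < Fintype.card F := by exact_mod_cast Fintype.card_pos
  rw [Fintype.piFinset_univ, Finset.card_univ, div_le_div_iff₀ (by positivity) hq] at h
  refine le_trans (by exact_mod_cast h) (Nat.mul_le_mul_right _ hd)

open Classical in
theorem MvPolynomial.card_zeros_mod_sq_le {p : ℕ} [Fact p.Prime] {n d : ℕ}
    {f : MvPolynomial (Fin n) ℤ} (hf : map (Int.castRingHom (ZMod p)) f ≠ 0)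
    (hd : f.totalDegree ≤ d) :
    (Finset.univ.filter fun y : Fin n → ZMod (p ^ 2) =>
      ZMod.castHom (dvd_pow_self p two_ne_zero) (ZMod p) (aeval y f) = 0).card * p ≤
      d * (p ^ 2) ^ n := by
  set φ := ZMod.castHom (dvd_pow_self p two_ne_zero) (ZMod p)
  have hz := card_zeros_le hf ((Finset.sup_mono (support_map_subset _ f)).trans hd)
  rw [ZMod.card] at hz
  have hfib := Finset.card_le_mul_card_image_of_maps_to
    (s := Finset.univ.filter fun y : Fin n → ZMod (p ^ 2) => φ (aeval y f) = 0)
    (t := Finset.univ.filter fun y : Fin n → ZMod p =>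
      eval y (map (Int.castRingHom (ZMod p)) f) = 0)
    (f := fun y i => φ (y i)) ?_ (p ^ n) ?_
  · calc _ ≤ p ^ n * _ * p := Nat.mul_le_mul_right _ hfib
      _ = p ^ n * (_ * p) := mul_assoc _ _ _
      _ ≤ p ^ n * (d * p ^ n) := Nat.mul_le_mul_left _ hz
      _ = d * (p ^ 2) ^ n := by ring
  · intro y hy
    have hy' : φ (aeval y f) = 0 := (Finset.mem_filter.1 hy).2
    refine Finset.mem_filter.2 ⟨Finset.mem_univ _, ?_⟩
    rw [← hy', map_aeval, eval_map, coe_eval₂Hom,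
      Subsingleton.elim (φ.comp (algebraMap ℤ (ZMod (p ^ 2)))) (Int.castRingHom (ZMod p))]
  · intro b _
    calc _ ≤ (Fintype.piFinset fun i => Finset.univ.filter fun a : ZMod (p ^ 2) =>
          φ a = b i).card := by
          refine Finset.card_le_card fun y hy => Fintype.mem_piFinset.2 fun i => ?_
          exact Finset.mem_filter.2 ⟨Finset.mem_univ _, congrFun (Finset.mem_filter.1 hy).2 i⟩
      _ ≤ p ^ n := by
          rw [Fintype.card_piFinset]
          refine (Finset.prod_le_pow_card _ _ p fun i _ =>
            ZMod.card_filter_castHom_eq_le (b i)).trans ?_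
          simp

open Classical in
theorem card_solutions_mod_sq_le {p : ℕ} [Fact p.Prime] (hp2 : p ≠ 2) {n k d : ℕ} (hk : 0 < k)
    {c : ℤ} (hc : ¬ (p : ℤ) ∣ c) {f : MvPolynomial (Fin n) ℤ}
    (hf : map (Int.castRingHom (ZMod p)) f ≠ 0) (hd : f.totalDegree ≤ d) :
    Nat.card {y : ZMod (p ^ 2) × (Fin n → ZMod (p ^ 2)) //
      (c : ZMod (p ^ 2)) * y.1 ^ k + aeval y.2 f = 0} ≤ (k + d) * (p ^ 2) ^ n := by
  set φ := ZMod.castHom (dvd_pow_self p two_ne_zero) (ZMod p)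
  have hcu : IsUnit (c : ZMod (p ^ 2)) := by
    refine ZMod.isUnit_of_castHom_ne_zero ?_
    rwa [map_intCast, Ne, ZMod.intCast_zmod_eq_zero_iff_dvd]
  obtain ⟨v, hv⟩ := hcu
  rw [Nat.card_eq_fintype_card, Fintype.card_subtype]
  let S₁ : Finset (ZMod (p ^ 2) × (Fin n → ZMod (p ^ 2))) :=
    Finset.univ.filter fun y => IsUnit y.1 ∧ (c : ZMod (p ^ 2)) * y.1 ^ k + aeval y.2 f = 0
  have h₁ : S₁.card ≤ k * (p ^ 2) ^ n := by
    have := Finset.card_le_mul_card_image_of_maps_to (s := S₁)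
      (t := (Finset.univ : Finset (Fin n → ZMod (p ^ 2)))) (f := Prod.snd)
      (fun _ _ => Finset.mem_univ _) k ?_
    · simpa [ZMod.card] using this
    · intro b _
      refine le_trans ?_ (ZMod.card_filter_isUnit_pow_eq_le hp2 hk
        (((v⁻¹ : (ZMod (p ^ 2))ˣ) : ZMod (p ^ 2)) * -aeval b f))
      refine Finset.card_le_card_of_injOn Prod.fst ?_ ?_
      · rintro ⟨x, y⟩ hy
        obtain ⟨hS, rfl⟩ := Finset.mem_filter.1 (Finset.mem_coe.1 hy)
        obtain ⟨-, hu, hsol⟩ := Finset.mem_filter.1 hS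
        refine Finset.mem_coe.2 (Finset.mem_filter.2 ⟨Finset.mem_univ _, hu, ?_⟩)
        rw [Units.eq_inv_mul_iff_mul_eq, hv]
        exact eq_neg_of_add_eq_zero_left hsol
      · rintro ⟨x, y⟩ hy ⟨x', y'⟩ hy' h
        exact Prod.ext h ((Finset.mem_filter.1 hy).2.trans (Finset.mem_filter.1 hy').2.symm)
  have h₂ := card_zeros_mod_sq_le hf hd
  have h₀ := ZMod.card_filter_castHom_eq_le (0 : ZMod p)
  calc _ ≤ (S₁ ∪ (Finset.univ.filter fun a : ZMod (p ^ 2) => φ a = 0) ×ˢ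
        (Finset.univ.filter fun y : Fin n → ZMod (p ^ 2) => φ (aeval y f) = 0)).card := by
        refine Finset.card_le_card fun y hy => ?_
        have hy := (Finset.mem_filter.1 hy).2
        rw [Finset.mem_union]
        by_cases h : φ y.1 = 0
        · refine Or.inr (Finset.mem_product.2 ⟨by simpa using h, ?_⟩)
          have := congrArg φ hy
          rw [map_add, map_mul, map_pow, h, zero_pow hk.ne', mul_zero, zero_add, map_zero] at this
          simpa using this
        · exact Or.inl (Finset.mem_filter.2
            ⟨Finset.mem_univ _, ZMod.isUnit_of_castHom_ne_zero h, hy⟩)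
    _ ≤ k * (p ^ 2) ^ n + d * (p ^ 2) ^ n := by
        refine (Finset.card_union_le _ _).trans (add_le_add h₁ ?_)
        rw [Finset.card_product, mul_comm]
        exact (Nat.mul_le_mul_left _ h₀).trans h₂
    _ = _ := by ring

theorem abs_prod_one_sub_sub_one_le {ι : Type*} (T : Finset ι) {a : ι → ℝ}
    (h₀ : ∀ i, 0 ≤ a i) (h₁ : ∀ i, a i ≤ 1) :
    |∏ i ∈ T, (1 - a i) - 1| ≤ ∑ i ∈ T, a i := by
  have hle : ∏ i ∈ T, (1 - a i) ≤ 1 :=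
    Finset.prod_le_one (fun i _ => sub_nonneg.2 (h₁ i)) fun i _ => sub_le_self _ (h₀ i)
  have hge : 1 - ∑ i ∈ T, a i ≤ ∏ i ∈ T, (1 - a i) := by
    classical
    induction T using Finset.induction_on with
    | empty => simp
    | insert i T hi ih =>
      have hle' : ∏ i ∈ T, (1 - a i) ≤ 1 :=
        Finset.prod_le_one (fun i _ => sub_nonneg.2 (h₁ i)) fun i _ => sub_le_self _ (h₀ i)
      have := ih hle'
      rw [Finset.sum_insert hi, Finset.prod_insert hi]
      nlinarith [h₀ i]
  rw [abs_sub_comm, abs_of_nonneg (sub_nonneg.2 hle)]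
  linarith

theorem abs_tprod_one_sub_sub_one_le {ι : Type*} {a : ι → ℝ} {B : ℝ}
    (h₀ : ∀ i, 0 ≤ a i) (h₁ : ∀ i, a i ≤ 1) (hB : ∀ T : Finset ι, ∑ i ∈ T, a i ≤ B) :
    |∏' i, (1 - a i) - 1| ≤ B := by
  by_cases hm : Multipliable fun i => 1 - a i
  · have ht : Filter.Tendsto (fun T : Finset ι => |∏ i ∈ T, (1 - a i) - 1|) Filter.atTop
        (nhds |∏' i, (1 - a i) - 1|) := (hm.hasProd.sub_const 1).abs
    exact le_of_tendsto' ht fun T => (abs_prod_one_sub_sub_one_le T h₀ h₁).trans (hB T)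
  · rw [tprod_eq_one_of_not_multipliable hm]
    simpa using hB ∅

theorem sum_primes_Ioc_log_div_sq_le {X : ℝ} (hX : 0 < X) (J : ℕ) :
    ∑ p ∈ Finset.Ioc ⌊X⌋₊ ⌊2 ^ J * X⌋₊ with p.Prime, Real.log p / (p : ℝ) ^ 2 ≤
      4 * Real.log 4 / X * (1 - (1 / 2) ^ J) := by
  induction J with
  | zero => simp
  | succ J ih =>
    set Y : ℝ := 2 ^ J * X with hYdef
    have hY : 0 < Y := by positivity
    have hY2 : (2 : ℝ) ^ (J + 1) * X = 2 * Y := by rw [hYdef]; ring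
    have hXY : X ≤ Y := le_mul_of_one_le_left hX.le (one_le_pow₀ one_le_two)
    rw [hY2]
    have hsplit : Finset.Ioc ⌊X⌋₊ ⌊2 * Y⌋₊ = Finset.Ioc ⌊X⌋₊ ⌊Y⌋₊ ∪ Finset.Ioc ⌊Y⌋₊ ⌊2 * Y⌋₊ :=
      (Finset.Ioc_union_Ioc_eq_Ioc (Nat.floor_mono hXY) (Nat.floor_mono (by linarith))).symm
    have hblock : ∑ p ∈ Finset.Ioc ⌊Y⌋₊ ⌊2 * Y⌋₊ with p.Prime, Real.log p / (p : ℝ) ^ 2 ≤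
        2 * Real.log 4 / Y := by
      calc _ ≤ ∑ p ∈ Finset.Ioc ⌊Y⌋₊ ⌊2 * Y⌋₊ with p.Prime, Real.log p / Y ^ 2 := by
            refine Finset.sum_le_sum fun p hp => ?_
            have hp' := (Finset.mem_Ioc.1 (Finset.mem_filter.1 hp).1).1
            have : Y < p := (Nat.floor_lt hY.le).1 hp'
            have := Real.log_natCast_nonneg p
            gcongr
        _ = (∑ p ∈ Finset.Ioc ⌊Y⌋₊ ⌊2 * Y⌋₊ with p.Prime, Real.log p) / Y ^ 2 := by
            rw [Finset.sum_div]
        _ ≤ Chebyshev.theta (2 * Y) / Y ^ 2 := by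
            refine div_le_div_of_nonneg_right ?_ (by positivity)
            refine Finset.sum_le_sum_of_subset_of_nonneg ?_ fun p _ _ => Real.log_natCast_nonneg p
            exact Finset.filter_subset_filter _ (Finset.Ioc_subset_Ioc_left (Nat.zero_le _))
        _ ≤ Real.log 4 * (2 * Y) / Y ^ 2 := by
            gcongr
            exact Chebyshev.theta_le_log4_mul_x (by positivity)
        _ = _ := by field_simp
    have hunion : ∑ p ∈ Finset.Ioc ⌊X⌋₊ ⌊2 * Y⌋₊ with p.Prime, Real.log p / (p : ℝ) ^ 2 ≤
        4 * Real.log 4 / X * (1 - (1 / 2) ^ J) + 2 * Real.log 4 / Y := by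
      rw [hsplit, Finset.filter_union, Finset.sum_union]
      · exact add_le_add ih hblock
      · refine Finset.disjoint_filter_filter (Finset.disjoint_left.2 fun p h h' => ?_)
        exact absurd (Finset.mem_Ioc.1 h).2 (not_le.2 (Finset.mem_Ioc.1 h').1)
    refine hunion.trans (le_of_eq ?_)
    rw [hYdef, one_div, inv_pow, inv_pow, pow_succ]
    field_simp
    ring

theorem sum_primes_gt_inv_sq_le {X : ℝ} (hX : 2 ≤ X)
    (T : Finset {q : Nat.Primes // X < ((q : ℕ) : ℝ)}) :
    ∑ p ∈ T, 1 / (((p : Nat.Primes) : ℕ) : ℝ) ^ 2 ≤ 4 * Real.log 4 / (X * Real.log X) := by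
  have hX0 : 0 < X := by linarith
  have hlog : 0 < Real.log X := Real.log_pos (by linarith)
  let e : {q : Nat.Primes // X < ((q : ℕ) : ℝ)} ↪ ℕ :=
    (Function.Embedding.subtype _).trans (Function.Embedding.subtype _)
  obtain ⟨J, hJ⟩ : ∃ J : ℕ, ∀ p ∈ T.map e, p ≤ ⌊(2 : ℝ) ^ J * X⌋₊ := by
    refine ⟨(T.map e).sup id, fun p hp => Nat.le_floor ?_⟩
    have h1 : p ≤ (T.map e).sup id := Finset.le_sup (f := id) hp
    have h2 : (p : ℝ) ≤ 2 ^ ((T.map e).sup id) := by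
      exact_mod_cast h1.trans Nat.lt_two_pow_self.le
    exact h2.trans (le_mul_of_one_le_right (by positivity) (by linarith))
  calc ∑ p ∈ T, 1 / (((p : Nat.Primes) : ℕ) : ℝ) ^ 2
      ≤ ∑ p ∈ T, (Real.log ((p : Nat.Primes) : ℕ) / (((p : Nat.Primes) : ℕ) : ℝ) ^ 2) /
          Real.log X := by
        refine Finset.sum_le_sum fun p _ => ?_
        have hp : X < ((p : Nat.Primes) : ℕ) := p.2
        have := Real.log_le_log hX0 hp.le
        rw [div_right_comm]
        gcongr
        rwa [one_le_div hlog]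
    _ = (∑ p ∈ T.map e, Real.log p / (p : ℝ) ^ 2) / Real.log X := by
        rw [Finset.sum_map, Finset.sum_div]
        rfl
    _ ≤ (∑ p ∈ Finset.Ioc ⌊X⌋₊ ⌊2 ^ J * X⌋₊ with p.Prime, Real.log p / (p : ℝ) ^ 2) /
          Real.log X := by
        refine div_le_div_of_nonneg_right ?_ hlog.le
        refine Finset.sum_le_sum_of_subset_of_nonneg (fun p hp => ?_) fun p _ _ =>
          div_nonneg (Real.log_natCast_nonneg p) (by positivity)
        have hle := hJ p hp
        obtain ⟨q, -, rfl⟩ := Finset.mem_map.1 hp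
        exact Finset.mem_filter.2
          ⟨Finset.mem_Ioc.2 ⟨(Nat.floor_lt hX0.le).2 q.2, hle⟩, q.1.2⟩
    _ ≤ (4 * Real.log 4 / X) / Real.log X := by
        refine div_le_div_of_nonneg_right ?_ hlog.le
        refine (sum_primes_Ioc_log_div_sq_le hX0 J).trans (mul_le_of_le_one_right ?_ ?_)
        · have := Real.log_pos (show (1 : ℝ) < 4 by norm_num)
          positivity
        · exact sub_le_self _ (by positivity)
    _ = _ := div_div _ _ _

/-- **Tail of the singular series.**
For `𝓟(x) = c x₁^k + 𝒞*(x₂,…,x_s)` with `k ∈ {3,4}`, `c ≠ 0` and `𝒞*` a non-degenerate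
integral cubic form, one has `∏_{p > X} (1 - ρ_𝓟(p²)/p^(2s)) = 1 + O(1/(X log X))`. -/
theorem singular_series_tail (s : ℕ) (hs : 3 ≤ s) (k : ℕ) (hk : k = 3 ∨ k = 4)
    (c : ℤ) (hc : c ≠ 0)
    (𝒞 : MvPolynomial (Fin (s - 1)) ℤ) (hhom : 𝒞.IsHomogeneous 3)
    (hdeg : ¬ ∃ (a : ℚ) (b : Fin (s - 1) → ℚ),
      MvPolynomial.map (Int.castRingHom ℚ) 𝒞 =
        MvPolynomial.C a * (∑ i, MvPolynomial.C (b i) * MvPolynomial.X i) ^ 3) :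
    ∃ K : ℝ, ∀ X : ℝ, 2 ≤ X →
      |(∏' p : {q : Nat.Primes // X < ((q : ℕ) : ℝ)},
          (1 - (Nat.card {y : ZMod (((p : Nat.Primes) : ℕ) ^ 2) ×
                (Fin (s - 1) → ZMod (((p : Nat.Primes) : ℕ) ^ 2)) //
              (c : ZMod (((p : Nat.Primes) : ℕ) ^ 2)) * y.1 ^ k + aeval y.2 𝒞 = 0} : ℝ) /
            (((p : Nat.Primes) : ℕ) : ℝ) ^ (2 * s))) - 1|
        ≤ K / (X * Real.log X) := by
  have h𝒞 : 𝒞 ≠ 0 := by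
    rintro rfl
    exact hdeg ⟨0, 0, by simp⟩
  obtain ⟨m, hm⟩ : ∃ m, coeff m 𝒞 ≠ 0 := by
    by_contra! h
    exact h𝒞 (MvPolynomial.ext _ _ h)
  have hs2 : 2 * s = 2 * (s - 1 + 1) := by omega
  let ρ : ℕ → ℕ := fun p => Nat.card {y : ZMod (p ^ 2) × (Fin (s - 1) → ZMod (p ^ 2)) //
    (c : ZMod (p ^ 2)) * y.1 ^ k + aeval y.2 𝒞 = 0}
  have htriv : ∀ p : ℕ, p.Prime → (ρ p : ℝ) / (p : ℝ) ^ (2 * s) ≤ 1 := by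
    intro p hp
    have : NeZero p := ⟨hp.ne_zero⟩
    have hle : ρ p ≤ p ^ (2 * s) := by
      refine (Finite.card_subtype_le _).trans (le_of_eq ?_)
      simp only [Nat.card_prod, Nat.card_fun, Nat.card_zmod, Nat.card_fin, hs2]
      ring
    exact div_le_one_of_le₀ (by exact_mod_cast hle) (by positivity)
  set M : ℕ := 2 + c.natAbs + (coeff m 𝒞).natAbs
  have hbound : ∀ p : ℕ, p.Prime →
      (ρ p : ℝ) / (p : ℝ) ^ (2 * s) ≤ (M ^ 2 + (k + 3) : ℝ) * (1 / (p : ℝ) ^ 2) := by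
    intro p hp
    have : Fact p.Prime := ⟨hp⟩
    have hp0 : (0 : ℝ) < p := by exact_mod_cast hp.pos
    rcases le_or_gt p M with hpM | hpM
    · refine (htriv p hp).trans ?_
      rw [mul_one_div, one_le_div (by positivity)]
      have : (p : ℝ) ≤ M := by exact_mod_cast hpM
      nlinarith [(k.cast_nonneg : (0 : ℝ) ≤ k)]
    · have hndvd : ∀ a : ℤ, a ≠ 0 → a.natAbs < p → ¬ (p : ℤ) ∣ a := fun a ha hap h =>
        absurd (Int.le_of_dvd (Int.natAbs_pos.2 ha |> Int.natCast_pos.2) (Int.dvd_natAbs.2 h))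
          (by omega)
      have hmap : map (Int.castRingHom (ZMod p)) 𝒞 ≠ 0 := by
        intro h
        have := congrArg (coeff m) h
        rw [coeff_map, coeff_zero, eq_intCast, ZMod.intCast_zmod_eq_zero_iff_dvd] at this
        exact hndvd _ hm (by omega) this
      have hle : ρ p ≤ (k + 3) * (p ^ 2) ^ (s - 1) :=
        card_solutions_mod_sq_le (by omega) (by omega) (hndvd c hc (by omega)) hmap
          hhom.totalDegree_le
      have hle' : (ρ p : ℝ) ≤ (k + 3) * ((p : ℝ) ^ 2) ^ (s - 1) := by exact_mod_cast hle
      rw [div_le_iff₀ (by positivity)]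
      calc (ρ p : ℝ) ≤ (k + 3) * ((p : ℝ) ^ 2) ^ (s - 1) := hle'
        _ ≤ (M ^ 2 + (k + 3)) * ((p : ℝ) ^ 2) ^ (s - 1) := by
          exact mul_le_mul_of_nonneg_right (le_add_of_nonneg_left (sq_nonneg _)) (by positivity)
        _ = _ := by
          rw [hs2]
          field_simp
          ring
  refine ⟨(M ^ 2 + (k + 3) : ℝ) * (4 * Real.log 4), fun X hX => ?_⟩
  refine abs_tprod_one_sub_sub_one_le
    (a := fun p : {q : Nat.Primes // X < ((q : ℕ) : ℝ)} =>
      (ρ ((p : Nat.Primes) : ℕ) : ℝ) / (((p : Nat.Primes) : ℕ) : ℝ) ^ (2 * s))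
    (fun _ => div_nonneg (Nat.cast_nonneg _) (pow_nonneg (Nat.cast_nonneg _) _))
    (fun p => htriv _ p.1.2) fun T => ?_
  refine (Finset.sum_le_sum fun p _ => hbound _ p.1.2).trans ?_
  rw [← Finset.mul_sum, mul_div_assoc]
  exact mul_le_mul_of_nonneg_left (sum_primes_gt_inv_sq_le hX T) (by positivity)
end
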